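/- Suppose α, β > 0, α(‖P‖ + β‖H‖²) < 1, and ρ ∈ (0, 2), and let (z^j, w^j, ξ^j, η^j) be the xPIPG iterates from arbitrary initial points ξ¹ ∈ ℝ^n, η¹ ∈ ℝ^m, with limits z̄ := lim_{j→∞} (z^{j+1} − z^j) and w̄ := lim_{j→∞} (w^{j+1} − w^j) (which exist). Then z̄ = π_{rec D}[z̄ − α(P z̄ + Hᵀ w̄)], w̄ = π_{K°}[w̄ + β H z̄], π_{(rec D)°}[z̄ − α(P z̄ + Hᵀ w̄)] = −α(P z̄ + Hᵀ w̄), and π_K[w̄ + β H z̄] = β H z̄. -/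

import Mathlib

open scoped RealInnerProductSpace
open Filter Topology Matrix

/-- Spectral norm (largest singular value) of a real matrix. -/
noncomputable def specNorm {ι κ : Type*} [Fintype ι] [Fintype κ] [DecidableEq κ]
    (A : Matrix ι κ ℝ) : ℝ :=
  ‖LinearMap.toContinuousLinearMap (Matrix.toEuclideanLin A)‖

/-- The linear map on Euclidean space induced by a matrix (matrix-vector product). -/
noncomputable def mvec {ι κ : Type*} [Fintype ι] [Fintype κ] [DecidableEq κ]
    (A : Matrix ι κ ℝ) (x : EuclideanSpace ℝ κ) : EuclideanSpace ℝ ι :=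
  Matrix.toEuclideanLin A x

open Classical in
/-- Projection onto a (nonempty closed convex) set: the minimizer of the distance to `x`. -/
noncomputable def proj {ι : Type*} [Fintype ι] (C : Set (EuclideanSpace ℝ ι))
    (x : EuclideanSpace ℝ ι) : EuclideanSpace ℝ ι :=
  if h : ∃ y ∈ C, ∀ c ∈ C, ‖x - y‖ ≤ ‖x - c‖ then h.choose else x

/-- Polar cone `K° = {w | ⟨w, y⟩ ≤ 0 for all y ∈ K}`. -/
def polarCone {ι : Type*} [Fintype ι] (K : Set (EuclideanSpace ℝ ι)) :
    Set (EuclideanSpace ℝ ι) := {w | ∀ y ∈ K, ⟪w, y⟫ ≤ 0}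

/-- Recession cone `rec D = {y | y + z ∈ D for all z ∈ D}`. -/
def recCone {ι : Type*} [Fintype ι] (D : Set (EuclideanSpace ℝ ι)) :
    Set (EuclideanSpace ℝ ι) := {y | ∀ z ∈ D, y + z ∈ D}

/-- Normal cone of `C` at `x`: `N_C(x) = {y | ⟨y, x' − x⟩ ≤ 0 for all x' ∈ C}`. -/
def normalCone {ι : Type*} [Fintype ι] (C : Set (EuclideanSpace ℝ ι))
    (x : EuclideanSpace ℝ ι) : Set (EuclideanSpace ℝ ι) :=
  {y | ∀ x' ∈ C, ⟪y, x' - x⟫ ≤ 0}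

/-- A closed convex cone. -/
def IsClosedConvexCone {ι : Type*} [Fintype ι] (K : Set (EuclideanSpace ℝ ι)) : Prop :=
  IsClosed K ∧ Convex ℝ K ∧ ∀ w ∈ K, ∀ c : ℝ, 0 ≤ c → c • w ∈ K

/-- Support function of `D`, valued in `EReal`: `σ_D(x) = sup_{y ∈ D} ⟨y, x⟩`. -/
noncomputable def supportF {ι : Type*} [Fintype ι] (D : Set (EuclideanSpace ℝ ι))
    (x : EuclideanSpace ℝ ι) : EReal :=
  ⨆ y : D, ((⟪(y : EuclideanSpace ℝ ι), x⟫ : ℝ) : EReal)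

section Projection

variable {ι : Type*} [Fintype ι] {C : Set (EuclideanSpace ℝ ι)}

/-- A point of `C` satisfying the variational inequality is the projection. -/
theorem proj_eq_of_inner_le_zero {x p : EuclideanSpace ℝ ι} (hp : p ∈ C)
    (h : ∀ c ∈ C, ⟪x - p, c - p⟫ ≤ 0) : proj C x = p := by
  have key : ∀ c ∈ C, ‖x - p‖ ^ 2 + ‖c - p‖ ^ 2 ≤ ‖x - c‖ ^ 2 := by
    intro c hc
    have h1 : x - c = (x - p) - (c - p) := by abel
    rw [h1, norm_sub_sq_real (x - p) (c - p)]
    linarith [h c hc]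
  have hex : ∃ y ∈ C, ∀ c ∈ C, ‖x - y‖ ≤ ‖x - c‖ :=
    ⟨p, hp, fun c hc => le_of_sq_le_sq (by nlinarith [key c hc, sq_nonneg ‖c - p‖])
      (norm_nonneg _)⟩
  rw [proj, dif_pos hex]
  obtain ⟨hr, hmin⟩ := hex.choose_spec
  have h2 := key _ hr
  have h3 := pow_le_pow_left₀ (norm_nonneg _) (hmin p hp) 2
  have h4 : ‖hex.choose - p‖ ^ 2 = 0 := le_antisymm (by linarith) (sq_nonneg _)
  exact sub_eq_zero.1 (norm_eq_zero.1 (pow_eq_zero_iff (by norm_num) |>.1 h4))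

theorem proj_mem_and_inner_le_zero (hne : C.Nonempty) (hcl : IsClosed C) (hcv : Convex ℝ C)
    (x : EuclideanSpace ℝ ι) :
    proj C x ∈ C ∧ ∀ c ∈ C, ⟪x - proj C x, c - proj C x⟫ ≤ 0 := by
  obtain ⟨p, hp, hmin⟩ := exists_norm_eq_iInf_of_complete_convex hne hcl.isComplete hcv x
  have hvi := (norm_eq_iInf_iff_real_inner_le_zero hcv hp).1 hmin
  rw [proj_eq_of_inner_le_zero hp hvi]
  exact ⟨hp, hvi⟩

theorem isClosedConvexCone_polarCone (K : Set (EuclideanSpace ℝ ι)) :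
    IsClosedConvexCone (polarCone K) := by
  refine ⟨?_, ?_, ?_⟩
  · simp only [polarCone, Set.ofPred_forall]
    exact isClosed_biInter fun y _ => isClosed_le (by fun_prop) continuous_const
  · intro a ha b hb s t hs ht _ y hy
    rw [inner_add_left, real_inner_smul_left, real_inner_smul_left]
    nlinarith [mul_nonpos_of_nonneg_of_nonpos hs (ha y hy),
      mul_nonpos_of_nonneg_of_nonpos ht (hb y hy)]
  · intro a ha c hc y hy
    rw [real_inner_smul_left]
    exact mul_nonpos_of_nonneg_of_nonpos hc (ha y hy)

theorem zero_mem_polarCone (K : Set (EuclideanSpace ℝ ι)) : 0 ∈ polarCone K :=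
  fun y _ => (inner_zero_left y).le

theorem recCone_polarCone (K : Set (EuclideanSpace ℝ ι)) :
    recCone (polarCone K) = polarCone K := by
  ext y
  refine ⟨fun h => by simpa using h 0 (zero_mem_polarCone K), fun h z hz x hx => ?_⟩
  rw [inner_add_left]
  exact add_nonpos (h x hx) (hz x hx)

/-- Bipolar theorem. -/
theorem polarCone_polarCone {K : Set (EuclideanSpace ℝ ι)} (hne : K.Nonempty)
    (hK : IsClosedConvexCone K) : polarCone (polarCone K) = K := by
  obtain ⟨hcl, hcv, hsm⟩ := hK
  ext x
  refine ⟨fun hx => ?_, fun hx y hy => by rw [real_inner_comm]; exact hy x hx⟩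
  obtain ⟨hp, hvi⟩ := proj_mem_and_inner_le_zero hne hcl hcv x
  set p := proj K x
  have h0 : (0 : EuclideanSpace ℝ ι) ∈ K := by simpa using hsm p hp 0 le_rfl
  have hp0 : 0 ≤ ⟪x - p, p⟫ := by simpa using hvi 0 h0
  have hp2 : ⟪x - p, p⟫ ≤ 0 := by
    have := hvi _ (hsm p hp 2 (by norm_num))
    rwa [two_smul, add_sub_cancel_right] at this
  have hpol : x - p ∈ polarCone K := fun y hy => by
    have := hvi y hy
    rw [inner_sub_right] at this
    linarith
  have h1 : ⟪x - p, x - p⟫ ≤ 0 := by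
    have h2 := hx _ hpol
    rw [real_inner_comm] at h2
    rw [inner_sub_right]
    linarith
  have h2 : x - p = 0 := inner_self_eq_zero.1 (le_antisymm h1 real_inner_self_nonneg)
  rwa [sub_eq_zero.1 h2]

/-- Moreau decomposition: an orthogonal sum of a cone element and a polar cone element. -/
theorem proj_add_of_mem_polarCone {y s : EuclideanSpace ℝ ι} (hy : y ∈ C)
    (hs : s ∈ polarCone C) (hsy : ⟪s, y⟫ = 0) :
    proj C (y + s) = y ∧ proj (polarCone C) (y + s) = s := by
  constructor
  · refine proj_eq_of_inner_le_zero hy fun c hc => ?_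
    rw [add_sub_cancel_left, inner_sub_right, hsy, sub_zero]
    exact hs c hc
  · refine proj_eq_of_inner_le_zero hs fun c hc => ?_
    rw [add_sub_cancel_right, inner_sub_right, real_inner_comm s y, hsy, sub_zero,
      real_inner_comm c y]
    exact hc y hy

/-- Asymptotic directions of a sequence of projections, and of the projected sequence, form an
orthogonal pair in the recession cone and its polar. -/
theorem proj_asymptotics (hne : C.Nonempty) (hcl : IsClosed C) (hcv : Convex ℝ C)
    {y a : ℕ → EuclideanSpace ℝ ι} {y' a' : EuclideanSpace ℝ ι} (hya : ∀ n, y n = proj C (a n))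
    (hy : Tendsto (fun n : ℕ => (n : ℝ)⁻¹ • y n) atTop (𝓝 y'))
    (ha : Tendsto (fun n : ℕ => (n : ℝ)⁻¹ • a n) atTop (𝓝 a')) :
    y' ∈ recCone C ∧ a' - y' ∈ polarCone (recCone C) ∧ ⟪a' - y', y'⟫ = 0 := by
  have hmem : ∀ n, y n ∈ C := fun n => by
    rw [hya]; exact (proj_mem_and_inner_le_zero hne hcl hcv _).1
  have hvi : ∀ n, ∀ c ∈ C, ⟪a n - y n, c - y n⟫ ≤ 0 := fun n => by
    rw [hya]; exact (proj_mem_and_inner_le_zero hne hcl hcv _).2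
  have hinv : Tendsto (fun n : ℕ => (n : ℝ)⁻¹) atTop (𝓝 0) := tendsto_inv_atTop_nhds_zero_nat
  have hdiff : Tendsto (fun n : ℕ => (n : ℝ)⁻¹ • (a n - y n)) atTop (𝓝 (a' - y')) := by
    simpa only [smul_sub] using ha.sub hy
  have hrec : y' ∈ recCone C := by
    intro c hc
    have hlim : Tendsto (fun n : ℕ => (n : ℝ)⁻¹ • y n + (1 - (n : ℝ)⁻¹) • c) atTop
        (𝓝 (y' + (1 - (0 : ℝ)) • c)) :=
      hy.add ((hinv.const_sub 1).smul_const c)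
    rw [sub_zero, one_smul] at hlim
    refine hcl.mem_of_tendsto hlim (Eventually.of_forall fun n => ?_)
    exact hcv (hmem n) hc (by positivity) (sub_nonneg.2 (Nat.cast_inv_le_one n)) (by ring)
  have hpol : a' - y' ∈ polarCone (recCone C) := by
    intro d hd
    refine le_of_tendsto (hdiff.inner tendsto_const_nhds) (Eventually.of_forall fun n => ?_)
    have h := hvi n _ (hd _ (hmem n))
    rw [add_sub_cancel_right] at h
    rw [real_inner_smul_left]
    exact mul_nonpos_of_nonneg_of_nonpos (by positivity) h
  refine ⟨hrec, hpol, le_antisymm (hpol y' hrec) ?_⟩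
  obtain ⟨c, hc⟩ := hne
  have hlim : Tendsto (fun n : ℕ => (n : ℝ)⁻¹ • (c - y n)) atTop (𝓝 ((0 : ℝ) • c - y')) := by
    simpa only [smul_sub] using (hinv.smul_const c).sub hy
  have h : ⟪a' - y', (0 : ℝ) • c - y'⟫ ≤ 0 := by
    refine le_of_tendsto (hdiff.inner hlim) (Eventually.of_forall fun n => ?_)
    rw [real_inner_smul_left, real_inner_smul_right]
    have := hvi n c hc
    have hn : (0 : ℝ) ≤ (n : ℝ)⁻¹ := by positivity
    exact mul_nonpos_of_nonneg_of_nonpos hn (mul_nonpos_of_nonneg_of_nonpos hn this)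
  simpa using h

end Projection

section Averaging

variable {E : Type*} [NormedAddCommGroup E] [NormedSpace ℝ E]

theorem tendsto_zero_of_le_mul_add {a e : ℕ → ℝ} {r : ℝ} (hr0 : 0 ≤ r) (hr1 : r < 1)
    (ha : ∀ n, 0 ≤ a n) (h : ∀ n, a (n + 1) ≤ r * a n + e n) (he : Tendsto e atTop (𝓝 0)) :
    Tendsto a atTop (𝓝 0) := by
  refine tendsto_order.2 ⟨fun b hb => Eventually.of_forall fun n => hb.trans_le (ha n),
    fun b hb => ?_⟩
  have hpos : 0 < (1 - r) * (b / 2) := mul_pos (sub_pos.2 hr1) (half_pos hb)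
  obtain ⟨N, hN⟩ := eventually_atTop.1 (he.eventually_lt_const hpos)
  have hbound : ∀ k, a (N + k) ≤ r ^ k * (a N - b / 2) + b / 2 := by
    intro k
    induction k with
    | zero => simp
    | succ k ih =>
      have h1 := h (N + k)
      have h2 := hN (N + k) (by omega)
      have h3 := mul_le_mul_of_nonneg_left ih hr0
      rw [← add_assoc, pow_succ]
      linarith
  have hlim : Tendsto (fun k : ℕ => r ^ k * (a N - b / 2) + b / 2) atTop
      (𝓝 (0 * (a N - b / 2) + b / 2)) :=
    ((tendsto_pow_atTop_nhds_zero_of_lt_one hr0 hr1).mul_const _).add_const _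
  obtain ⟨M, hM⟩ := eventually_atTop.1 (hlim.eventually_lt_const (by linarith : _ < b))
  refine eventually_atTop.2 ⟨N + M, fun n hn => ?_⟩
  obtain ⟨k, rfl⟩ := Nat.exists_eq_add_of_le (show N ≤ n by omega)
  exact (hbound k).trans_lt (hM k (by omega))

theorem tendsto_of_relaxation {d e : ℕ → E} {l : E} {ρ : ℝ} (hρ : ρ ∈ Set.Ioo (0 : ℝ) 2)
    (h : ∀ n, d (n + 1) = (1 - ρ) • d n + ρ • e n) (he : Tendsto e atTop (𝓝 l)) :
    Tendsto d atTop (𝓝 l) := by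
  obtain ⟨h0, h2⟩ := hρ
  rw [tendsto_iff_norm_sub_tendsto_zero] at he ⊢
  refine tendsto_zero_of_le_mul_add (r := |1 - ρ|) (e := fun n => |ρ| * ‖e n - l‖)
    (abs_nonneg _) (abs_lt.2 ⟨by linarith, by linarith⟩) (fun n => norm_nonneg _)
    (fun n => ?_) (by simpa using he.const_mul |ρ|)
  have heq : d (n + 1) - l = (1 - ρ) • (d n - l) + ρ • (e n - l) := by rw [h]; module
  rw [heq]
  refine (norm_add_le _ _).trans_eq ?_
  rw [norm_smul, norm_smul, Real.norm_eq_abs, Real.norm_eq_abs]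

/-- If the increments of a sequence converge, the sequence grows linearly at their limit. -/
theorem tendsto_inv_smul_of_tendsto_sub {x : ℕ → E} {l : E}
    (h : Tendsto (fun n => x (n + 1) - x n) atTop (𝓝 l)) :
    Tendsto (fun n : ℕ => (n : ℝ)⁻¹ • x n) atTop (𝓝 l) := by
  have hinv : Tendsto (fun n : ℕ => (n : ℝ)⁻¹) atTop (𝓝 0) := tendsto_inv_atTop_nhds_zero_nat
  have h1 := h.cesaro_smul.add (hinv.smul_const (x 0))
  simpa only [Finset.sum_range_sub, ← smul_add, sub_add_cancel, zero_smul, add_zero] using h1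

/-- A relaxed sequence inherits the growth rate of the driving sequence. -/
theorem tendsto_inv_smul_of_relaxation {x y : ℕ → E} {l : E} {ρ : ℝ}
    (hρ : ρ ∈ Set.Ioo (0 : ℝ) 2)
    (hx : ∀ j, 1 ≤ j → x (j + 1) = (1 - ρ) • x j + ρ • y (j + 1))
    (hy : Tendsto (fun j : ℕ => y (j + 1) - y j) atTop (𝓝 l)) :
    Tendsto (fun n : ℕ => (n : ℝ)⁻¹ • x (n + 1)) atTop (𝓝 l) ∧
      Tendsto (fun n : ℕ => (n : ℝ)⁻¹ • y (n + 2)) atTop (𝓝 l) := by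
  have hy2 : Tendsto (fun n : ℕ => y (n + 2 + 1) - y (n + 2)) atTop (𝓝 l) :=
    hy.comp (tendsto_add_atTop_nat 2)
  refine ⟨tendsto_inv_smul_of_tendsto_sub (x := fun n => x (n + 1))
    (tendsto_of_relaxation hρ (fun n => ?_) hy2), tendsto_inv_smul_of_tendsto_sub
    (x := fun n => y (n + 2)) (by simpa only [add_right_comm] using hy2)⟩
  rw [hx (n + 1 + 1) (by omega), hx (n + 1) (by omega)]
  module

end Averaging

section MatrixAction

variable {ι κ : Type*} [Fintype ι] [Fintype κ] [DecidableEq κ] (A : Matrix ι κ ℝ)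

theorem mvec_smul (c : ℝ) (x : EuclideanSpace ℝ κ) : mvec A (c • x) = c • mvec A x :=
  map_smul (Matrix.toEuclideanLin A) c x

theorem continuous_mvec : Continuous (mvec A) :=
  (Matrix.toEuclideanLin A).continuous_of_finiteDimensional

theorem tendsto_inv_smul_mvec {x : ℕ → EuclideanSpace ℝ κ} {l : EuclideanSpace ℝ κ}
    (h : Tendsto (fun n : ℕ => (n : ℝ)⁻¹ • x n) atTop (𝓝 l)) :
    Tendsto (fun n : ℕ => (n : ℝ)⁻¹ • mvec A (x n)) atTop (𝓝 (mvec A l)) := by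
  simpa only [Function.comp_def, mvec_smul] using ((continuous_mvec A).tendsto l).comp h

end MatrixAction

/-- fixed-point/projection identities satisfied by the xPIPG limits. -/
theorem stmt16 {n m : ℕ} (P : Matrix (Fin n) (Fin n) ℝ) (q : EuclideanSpace ℝ (Fin n))
    (H : Matrix (Fin m) (Fin n) ℝ) (g : EuclideanSpace ℝ (Fin m))
    (D : Set (EuclideanSpace ℝ (Fin n))) (K : Set (EuclideanSpace ℝ (Fin m)))
    (hP : P.PosSemidef)
    (hDne : D.Nonempty) (hDcl : IsClosed D) (hDcv : Convex ℝ D)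
    (hKne : K.Nonempty) (hK : IsClosedConvexCone K)
    (α β ρ : ℝ) (hα : 0 < α) (hβ : 0 < β)
    (hstep : α * (specNorm P + β * specNorm H ^ 2) < 1)
    (hρ : ρ ∈ Set.Ioo (0 : ℝ) 2)
    (z ξ : ℕ → EuclideanSpace ℝ (Fin n)) (w η : ℕ → EuclideanSpace ℝ (Fin m))
    (hz : ∀ j, 1 ≤ j → z (j + 1) = proj D (ξ j - α • (mvec P (ξ j) + q + mvec Hᵀ (η j))))
    (hw : ∀ j, 1 ≤ j → w (j + 1) =
      proj (polarCone K) (η j + β • (mvec H ((2 : ℝ) • z (j + 1) - ξ j) - g)))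
    (hξ : ∀ j, 1 ≤ j → ξ (j + 1) = (1 - ρ) • ξ j + ρ • z (j + 1))
    (hη : ∀ j, 1 ≤ j → η (j + 1) = (1 - ρ) • η j + ρ • w (j + 1))
    (zbar : EuclideanSpace ℝ (Fin n)) (wbar : EuclideanSpace ℝ (Fin m))
    (hzbar : Tendsto (fun j : ℕ => z (j + 1) - z j) atTop (𝓝 zbar))
    (hwbar : Tendsto (fun j : ℕ => w (j + 1) - w j) atTop (𝓝 wbar)) :
    zbar = proj (recCone D) (zbar - α • (mvec P zbar + mvec Hᵀ wbar)) ∧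
    wbar = proj (polarCone K) (wbar + β • mvec H zbar) ∧
    proj (polarCone (recCone D)) (zbar - α • (mvec P zbar + mvec Hᵀ wbar)) =
      -(α • (mvec P zbar + mvec Hᵀ wbar)) ∧
    proj K (wbar + β • mvec H zbar) = β • mvec H zbar := by
  have hinv : Tendsto (fun n : ℕ => (n : ℝ)⁻¹) atTop (𝓝 0) := tendsto_inv_atTop_nhds_zero_nat
  obtain ⟨hX, hZ⟩ := tendsto_inv_smul_of_relaxation hρ hξ hzbar
  obtain ⟨hE, hW⟩ := tendsto_inv_smul_of_relaxation hρ hη hwbar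
  have haz : Tendsto (fun n : ℕ => (n : ℝ)⁻¹ •
      (ξ (n + 1) - α • (mvec P (ξ (n + 1)) + q + mvec Hᵀ (η (n + 1))))) atTop
      (𝓝 (zbar - α • (mvec P zbar + mvec Hᵀ wbar))) := by
    have h := hX.sub ((((tendsto_inv_smul_mvec P hX).add (hinv.smul_const q)).add
      (tendsto_inv_smul_mvec Hᵀ hE)).const_smul α)
    rw [zero_smul, add_zero] at h
    exact h.congr fun n => by module
  have hext : Tendsto (fun n : ℕ => (n : ℝ)⁻¹ • ((2 : ℝ) • z (n + 2) - ξ (n + 1))) atTop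
      (𝓝 zbar) := by
    have h := (hZ.const_smul (2 : ℝ)).sub hX
    rw [show (2 : ℝ) • zbar - zbar = zbar by module] at h
    exact h.congr fun n => by module
  have haw : Tendsto (fun n : ℕ => (n : ℝ)⁻¹ •
      (η (n + 1) + β • (mvec H ((2 : ℝ) • z (n + 2) - ξ (n + 1)) - g))) atTop
      (𝓝 (wbar + β • mvec H zbar)) := by
    have h := hE.add (((tendsto_inv_smul_mvec H hext).sub (hinv.smul_const g)).const_smul β)
    rw [zero_smul, sub_zero] at h
    exact h.congr fun n => by module
  obtain ⟨hz1, hz2, hz3⟩ := proj_asymptotics hDne hDcl hDcv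
    (y := fun n => z (n + 2)) (fun n => hz (n + 1) (by omega)) hZ haz
  obtain ⟨hpcl, hpcv, -⟩ := isClosedConvexCone_polarCone K
  obtain ⟨hw1, hw2, hw3⟩ := proj_asymptotics ⟨0, zero_mem_polarCone K⟩ hpcl hpcv
    (y := fun n => w (n + 2)) (fun n => hw (n + 1) (by omega)) hW haw
  obtain ⟨hz4, hz5⟩ := proj_add_of_mem_polarCone hz1 hz2 hz3
  rw [recCone_polarCone] at hw1 hw2
  obtain ⟨hw4, hw5⟩ := proj_add_of_mem_polarCone hw1 hw2 hw3
  rw [polarCone_polarCone hKne hK] at hw5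
  rw [add_sub_cancel] at hz4 hz5 hw4 hw5
  exact ⟨hz4.symm, hw4.symm, hz5.trans (by abel), hw5.trans (by abel)⟩
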